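/- Let G be a finite group of exponent m and let S ⊆ G be conjugation-closed (g⁻¹Sg = S for all g ∈ G). Let B be the adjacency matrix of the Cayley digraph Cay(G, S): the matrix over ℚ indexed by G with B[h, g] = 1 if g·h⁻¹ ∈ S and 0 otherwise. Then the splitting field SF(Cay(G, S)) — the subfield of ℂ generated over ℚ by all complex roots of the characteristic polynomial of B — equals the subfield of ℂ generated over ℚ by the values χ(S), χ ranging over the irreducible complex characters of G; and [SF(Cay(G, S)) : ℚ]·|T| = φ(m), where T = {t ∈ (ℤ/mℤ)ˣ : S^t = S} with S^t = {s^t : s ∈ S}, and φ is Euler's totient function. -/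

import Mathlib

open IntermediateField

/-- The adjacency matrix (over ℚ, with 0/1 entries) of the Cayley digraph `Cay(G, S)`. -/
def cayMatrix {G : Type*} [Group G] [DecidableEq G] (S : Finset G) : Matrix G G ℚ :=
  fun h g => if g * h⁻¹ ∈ S then 1 else 0

/-- `χ : G → ℂ` is an irreducible complex character of `G` if it is the trace function of
a nonzero irreducible finite-dimensional complex representation of `G`. -/
def IsIrrChar (G : Type*) [Group G] (χ : G → ℂ) : Prop :=
  ∃ (V : Type) (_ : AddCommGroup V) (_ : Module ℂ V) (_ : FiniteDimensional ℂ V)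
    (_ : Nontrivial V) (ρ : Representation ℂ G V),
    (∀ W : Submodule ℂ V, (∀ g : G, ∀ v ∈ W, ρ g v ∈ W) → W = ⊥ ∨ W = ⊤) ∧
    ∀ g : G, χ g = LinearMap.trace ℂ V (ρ g)

section

open Module

section ConjugationClosed

variable {G : Type*} [Group G] [DecidableEq G] {S : Finset G}

lemma sum_conj_eq {M : Type*} [AddCommMonoid M]
    (hS : ∀ g : G, S.image (fun x => g⁻¹ * x * g) = S) (g : G) (F : G → M) :
    ∑ s ∈ S, F (g⁻¹ * s * g) = ∑ s ∈ S, F s := by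
  conv_rhs => rw [← hS g]
  rw [Finset.sum_image]
  intro x _ y _ h
  simpa using h

lemma image_pow_conj (hS : ∀ g : G, S.image (fun x => g⁻¹ * x * g) = S) (t : ℕ) (g : G) :
    (S.image (fun s => s ^ t)).image (fun x => g⁻¹ * x * g) = S.image (fun s => s ^ t) := by
  conv_rhs => rw [← hS g]
  rw [Finset.image_image, Finset.image_image]
  congr 1
  funext x
  simpa using (conj_pow (a := g⁻¹) (b := x) (i := t)).symm

variable {V : Type*} [AddCommGroup V] [Module ℂ V] (ρ : Representation ℂ G V)

lemma sum_representation_comm (hS : ∀ g : G, S.image (fun x => g⁻¹ * x * g) = S) (g : G) (v : V) :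
    (∑ s ∈ S, ρ s) (ρ g v) = ρ g ((∑ s ∈ S, ρ s) v) := by
  have h := sum_conj_eq hS g (fun s => ρ g (ρ s v))
  simp only [LinearMap.sum_apply, map_sum]
  rw [← h]
  refine Finset.sum_congr rfl fun s _ => ?_
  simp only [← Module.End.mul_apply, ← map_mul]
  congr 2
  group

/-- Schur's lemma for class sums. -/
lemma exists_sum_representation_eq_smul [FiniteDimensional ℂ V] [Nontrivial V]
    (hρ : ∀ W : Submodule ℂ V, (∀ g : G, ∀ v ∈ W, ρ g v ∈ W) → W = ⊥ ∨ W = ⊤)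
    (hS : ∀ g : G, S.image (fun x => g⁻¹ * x * g) = S) :
    ∃ c : ℂ, (∀ v, (∑ s ∈ S, ρ s) v = c • v) ∧
      ∑ s ∈ S, LinearMap.trace ℂ V (ρ s) = c * finrank ℂ V := by
  obtain ⟨c, hc⟩ := Module.End.exists_eigenvalue (∑ s ∈ S, ρ s)
  have h := hρ (Module.End.eigenspace (∑ s ∈ S, ρ s) c) fun g v hv => by
    rw [Module.End.mem_eigenspace_iff] at hv ⊢
    rw [sum_representation_comm ρ hS, hv, map_smul]
  have htop := h.resolve_left hc
  have hsmul : ∀ v, (∑ s ∈ S, ρ s) v = c • v := fun v => by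
    rw [← Module.End.mem_eigenspace_iff, htop]
    trivial
  refine ⟨c, hsmul, ?_⟩
  have hD : ∑ s ∈ S, ρ s = c • LinearMap.id := LinearMap.ext hsmul
  rw [← map_sum, hD, map_smul, LinearMap.trace_id, smul_eq_mul]

end ConjugationClosed

section IrreducibleConstituent

variable {G : Type*} [Group G] {V : Type*} [AddCommGroup V] [Module ℂ V] [FiniteDimensional ℂ V]

lemma exists_minimal_invariant (ρ : Representation ℂ G V) {E : Submodule ℂ V} (hE : E ≠ ⊥)
    (hinv : ∀ g : G, ∀ v ∈ E, ρ g v ∈ E) :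
    ∃ W ≤ E, W ≠ ⊥ ∧ (∀ g : G, ∀ v ∈ W, ρ g v ∈ W) ∧
      ∀ U ≤ W, (∀ g : G, ∀ v ∈ U, ρ g v ∈ U) → U = ⊥ ∨ U = W := by
  obtain ⟨W, ⟨h1, h2, h3⟩, hmin⟩ := (wellFounded_lt (α := Submodule ℂ V)).has_min
    {W | W ≤ E ∧ W ≠ ⊥ ∧ ∀ g : G, ∀ v ∈ W, ρ g v ∈ W} ⟨E, le_rfl, hE, hinv⟩
  refine ⟨W, h1, h2, h3, fun U hU hUinv => ?_⟩
  by_contra! h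
  exact hmin U ⟨hU.trans h1, h.1, hUinv⟩ (lt_of_le_of_ne hU h.2)

lemma isIrrChar_trace (ρ : Representation ℂ G V) [Nontrivial V]
    (hρ : ∀ W : Submodule ℂ V, (∀ g : G, ∀ v ∈ W, ρ g v ∈ W) → W = ⊥ ∨ W = ⊤) :
    IsIrrChar G (fun g => LinearMap.trace ℂ V (ρ g)) := by
  let e : V ≃ₗ[ℂ] (Fin (finrank ℂ V) → ℂ) := (finBasis ℂ V).equivFun
  let ρ' : Representation ℂ G (Fin (finrank ℂ V) → ℂ) :=
    { toFun := fun g => e.conj (ρ g)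
      map_one' := by ext; simp
      map_mul' := fun g h => by rw [map_mul, Module.End.mul_eq_comp, LinearEquiv.conj_comp]; rfl }
  refine ⟨Fin (finrank ℂ V) → ℂ, inferInstance, inferInstance, inferInstance,
    e.symm.toEquiv.nontrivial, ρ', fun W hW => ?_, fun g => (LinearMap.trace_conj' (ρ g) e).symm⟩
  have h := hρ (W.comap e.toLinearMap) fun g v hv => by
    have := hW g (e v) hv
    simpa [ρ', LinearEquiv.conj_apply] using this
  refine h.imp (fun h => ?_) fun h => ?_
  · rw [Submodule.eq_bot_iff] at h ⊢
    intro x hx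
    simpa using h (e.symm x) (by simpa using hx)
  · rw [Submodule.eq_top_iff'] at h ⊢
    intro x
    simpa using h (e.symm x)

/-- Every nonzero invariant subspace contains a nonzero subspace affording an irreducible
character, on which all class sums act as scalars. -/
lemma exists_isIrrChar_of_invariant [DecidableEq G] (ρ : Representation ℂ G V)
    {E : Submodule ℂ V} (hE : E ≠ ⊥) (hinv : ∀ g : G, ∀ v ∈ E, ρ g v ∈ E) :
    ∃ W ≤ E, W ≠ ⊥ ∧ ∃ χ : G → ℂ, IsIrrChar G χ ∧
      ∀ S : Finset G, (∀ g : G, S.image (fun x => g⁻¹ * x * g) = S) →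
        ∃ c : ℂ, (∀ v ∈ W, (∑ s ∈ S, ρ s) v = c • v) ∧ ∑ s ∈ S, χ s = c * finrank ℂ W := by
  obtain ⟨W, hWE, hW, hWinv, hmin⟩ := exists_minimal_invariant ρ hE hinv
  let τ : Representation ℂ G W :=
    (⟨W, fun g _ hv => hWinv g _ hv⟩ : Subrepresentation ρ).toRepresentation
  have hτ (g : G) (w : W) : (τ g w : V) = ρ g w := rfl
  have hirr : ∀ U : Submodule ℂ W, (∀ g : G, ∀ v ∈ U, τ g v ∈ U) → U = ⊥ ∨ U = ⊤ := by
    intro U hU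
    have h := hmin (U.map W.subtype) (Submodule.map_subtype_le W U) <| by
      rintro g _ ⟨w, hw, rfl⟩
      exact ⟨τ g w, hU g w hw, rfl⟩
    refine h.imp (fun h => ?_) fun h => ?_
    · apply Submodule.map_injective_of_injective W.injective_subtype
      rw [h, Submodule.map_bot]
    · apply Submodule.map_injective_of_injective W.injective_subtype
      rw [h, Submodule.map_top, Submodule.range_subtype]
  have : Nontrivial W := Submodule.nontrivial_iff_ne_bot.2 hW
  refine ⟨W, hWE, hW, _, isIrrChar_trace τ hirr, fun S hS => ?_⟩
  obtain ⟨c, hc, htr⟩ := exists_sum_representation_eq_smul τ hirr hS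
  refine ⟨c, fun v hv => ?_, htr⟩
  have := congrArg (Subtype.val) (hc ⟨v, hv⟩)
  simpa [LinearMap.sum_apply, hτ] using this

end IrreducibleConstituent

section RegularRepresentation

variable {G : Type*} [Group G]

/-- The right regular representation on functions. -/
def regularRep (G : Type*) [Group G] : Representation ℂ G (G → ℂ) where
  toFun g := LinearMap.funLeft ℂ ℂ (fun h => h * g)
  map_one' := by ext; simp [LinearMap.funLeft]
  map_mul' g h := by
    refine LinearMap.ext fun f => funext fun x => ?_
    simp [LinearMap.funLeft_apply, mul_assoc]

@[simp]
lemma regularRep_apply (g : G) (f : G → ℂ) (h : G) : regularRep G g f h = f (h * g) := rfl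

lemma eq_of_forall_isIrrChar_sum_eq [Fintype G] [DecidableEq G] {S S' : Finset G}
    (hS : ∀ g : G, S.image (fun x => g⁻¹ * x * g) = S)
    (hS' : ∀ g : G, S'.image (fun x => g⁻¹ * x * g) = S')
    (h : ∀ χ : G → ℂ, IsIrrChar G χ → ∑ s ∈ S, χ s = ∑ s ∈ S', χ s) : S = S' := by
  let ρ := regularRep G
  let D : Module.End ℂ (G → ℂ) := ∑ s ∈ S, ρ s - ∑ s ∈ S', ρ s
  let N : Subrepresentation ρ := ⟨LinearMap.ker D, fun g v hv => by
    rw [LinearMap.mem_ker, LinearMap.sub_apply] at hv ⊢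
    rw [sum_representation_comm ρ hS, sum_representation_comm ρ hS', ← map_sub, hv, map_zero]⟩
  obtain ⟨C, hC⟩ := exists_isCompl N
  have hCbot : C.toSubmodule = ⊥ := by
    by_contra hne
    obtain ⟨W, hWC, hW, χ, hχ, hc⟩ := exists_isIrrChar_of_invariant ρ hne
      fun g _ hv => C.apply_mem_toSubmodule g hv
    obtain ⟨c, hc1, hc2⟩ := hc S hS
    obtain ⟨c', hc1', hc2'⟩ := hc S' hS'
    have hpos : (finrank ℂ W : ℂ) ≠ 0 := by
      rw [Nat.cast_ne_zero, Ne, Submodule.finrank_eq_zero]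
      exact hW
    have hcc : c = c' := mul_right_cancel₀ hpos (by rw [← hc2, ← hc2', h χ hχ])
    have hinf : N ⊓ C = ⊥ := hC.inf_eq_bot
    apply hW
    rw [Submodule.eq_bot_iff]
    intro w hw
    have hmem : w ∈ (N ⊓ C).toSubmodule := by
      refine ⟨?_, hWC hw⟩
      change D w = 0
      rw [LinearMap.sub_apply, hc1 w hw, hc1' w hw, hcc, sub_self]
    rw [hinf] at hmem
    exact hmem
  have hNtop : N = ⊤ := by
    have : C = ⊥ := Subrepresentation.toSubmodule_injective hCbot
    rw [← hC.sup_eq_top, this, sup_bot_eq]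
  ext x
  have hx : Pi.single x 1 ∈ N.toSubmodule := by rw [hNtop]; trivial
  have hx1 : D (Pi.single x 1) = 0 := hx
  have := congrFun hx1 1
  simp only [D, ρ, LinearMap.sub_apply, LinearMap.sum_apply, Pi.sub_apply, Finset.sum_apply,
    regularRep_apply, one_mul, Pi.zero_apply, Pi.single_apply, Finset.sum_ite_eq'] at this
  by_cases h1 : x ∈ S <;> by_cases h2 : x ∈ S' <;> simp_all

end RegularRepresentation

section CayleyEigenvalues

variable {G : Type*} [Group G] [Fintype G] [DecidableEq G] {S : Finset G}

lemma aeval_charpoly_cayMatrix_eq_zero_iff (z : ℂ) :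
    Polynomial.aeval z (cayMatrix S).charpoly = 0 ↔
      ∃ f : G → ℂ, f ≠ 0 ∧ ∀ h, ∑ s ∈ S, f (s * h) = z * f h := by
  have key (f : G → ℂ) (h : G) :
      Matrix.toLin' ((cayMatrix S).map (algebraMap ℚ ℂ)) f h = ∑ s ∈ S, f (s * h) := by
    rw [Matrix.toLin'_apply, Matrix.mulVec, dotProduct]
    simp only [Matrix.map_apply, cayMatrix, apply_ite (algebraMap ℚ ℂ), map_one, map_zero,
      ite_mul, one_mul, zero_mul]
    rw [← Equiv.sum_comp (Equiv.mulRight h)]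
    simp
  rw [Polynomial.aeval_def, ← Polynomial.eval_map, ← Matrix.charpoly_map,
    ← Polynomial.IsRoot.def, ← Matrix.mem_spectrum_iff_isRoot_charpoly, ← Matrix.spectrum_toLin',
    ← Module.End.hasEigenvalue_iff_mem_spectrum]
  constructor
  · intro hz
    obtain ⟨f, hf⟩ := hz.exists_hasEigenvector
    refine ⟨f, hf.2, fun h => ?_⟩
    rw [← key, hf.apply_eq_smul, Pi.smul_apply, smul_eq_mul]
  · rintro ⟨f, hf, hfz⟩
    refine Module.End.hasEigenvalue_of_hasEigenvector (x := f) ⟨?_, hf⟩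
    rw [Module.End.mem_eigenspace_iff]
    ext h
    rw [key, hfz, Pi.smul_apply, smul_eq_mul]

lemma exists_isIrrChar_of_root (hS : ∀ g : G, S.image (fun x => g⁻¹ * x * g) = S) {z : ℂ}
    (hz : Polynomial.aeval z (cayMatrix S).charpoly = 0) :
    ∃ χ : G → ℂ, IsIrrChar G χ ∧ ∃ n : ℕ, n ≠ 0 ∧ ∑ s ∈ S, χ s = z * n := by
  obtain ⟨f, hf, hfz⟩ := (aeval_charpoly_cayMatrix_eq_zero_iff z).1 hz
  let ρ := regularRep G
  let E := Module.End.eigenspace (∑ s ∈ S, ρ s) z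
  have hfE : f ∈ E := by
    rw [Module.End.mem_eigenspace_iff]
    ext h
    rw [Pi.smul_apply, smul_eq_mul, ← hfz h, LinearMap.sum_apply, Finset.sum_apply]
    simp only [ρ, regularRep_apply]
    rw [← sum_conj_eq hS h fun s => f (h * s)]
    simp [← mul_assoc]
  have hE : E ≠ ⊥ := fun h => hf <| by rwa [h, Submodule.mem_bot] at hfE
  obtain ⟨W, hWE, hW, χ, hχ, hc⟩ := exists_isIrrChar_of_invariant ρ hE fun g v hv => by
    rw [Module.End.mem_eigenspace_iff] at hv ⊢
    rw [sum_representation_comm ρ hS, hv, map_smul]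
  obtain ⟨c, hc1, hc2⟩ := hc S hS
  refine ⟨χ, hχ, finrank ℂ W, by rwa [Ne, Submodule.finrank_eq_zero], ?_⟩
  obtain ⟨w, hw, hw0⟩ := W.ne_bot_iff.1 hW
  have h1 := Module.End.mem_eigenspace_iff.1 (hWE hw)
  rw [hc1 w hw] at h1
  rw [hc2, smul_left_injective ℂ hw0 h1]

lemma exists_root_of_isIrrChar (hS : ∀ g : G, S.image (fun x => g⁻¹ * x * g) = S) {χ : G → ℂ}
    (hχ : IsIrrChar G χ) :
    ∃ z : ℂ, Polynomial.aeval z (cayMatrix S).charpoly = 0 ∧ ∃ n : ℕ, ∑ s ∈ S, χ s = z * n := by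
  obtain ⟨V, _, _, _, _, ρ, hρ, hχρ⟩ := hχ
  obtain ⟨c, hc, htr⟩ := exists_sum_representation_eq_smul ρ hρ hS
  refine ⟨c, ?_, finrank ℂ V, by simpa only [hχρ] using htr⟩
  rw [aeval_charpoly_cayMatrix_eq_zero_iff]
  obtain ⟨v, hv⟩ := exists_ne (0 : V)
  obtain ⟨l, hl⟩ : ∃ l : Module.Dual ℂ V, l v ≠ 0 := by
    by_contra! h
    exact hv ((Module.forall_dual_apply_eq_zero_iff ℂ v).1 h)
  refine ⟨fun g => l (ρ g v), fun h0 => hl ?_, fun h => ?_⟩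
  · simpa using congrFun h0 1
  · have := congrArg l (hc (ρ h v))
    simpa [LinearMap.sum_apply, map_mul] using this

lemma adjoin_roots_eq_adjoin_characters (hS : ∀ g : G, S.image (fun x => g⁻¹ * x * g) = S) :
    IntermediateField.adjoin ℚ {z : ℂ | Polynomial.aeval z (cayMatrix S).charpoly = 0} =
      IntermediateField.adjoin ℚ {z : ℂ | ∃ χ : G → ℂ, IsIrrChar G χ ∧ z = ∑ s ∈ S, χ s} := by
  apply le_antisymm <;> rw [IntermediateField.adjoin_le_iff]
  · intro z hz
    obtain ⟨χ, hχ, n, hn, h⟩ := exists_isIrrChar_of_root hS hz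
    have hz' : z = (∑ s ∈ S, χ s) / n := by
      rw [h, mul_div_cancel_right₀ _ (Nat.cast_ne_zero.2 hn)]
    rw [hz']
    exact div_mem (IntermediateField.subset_adjoin _ _ ⟨χ, hχ, rfl⟩) (_root_.natCast_mem _ n)
  · rintro _ ⟨χ, hχ, rfl⟩
    obtain ⟨z, hz, n, h⟩ := exists_root_of_isIrrChar hS hχ
    rw [h]
    exact mul_mem (IntermediateField.subset_adjoin _ _ hz) (_root_.natCast_mem _ n)

end CayleyEigenvalues

section GaloisAction

/-- The trace of every power of an endomorphism of finite order, in terms of its eigenvalues. -/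
lemma exists_trace_pow_eq_sum {V : Type*} [AddCommGroup V] [Module ℂ V] [FiniteDimensional ℂ V]
    {m : ℕ} (hm : m ≠ 0) {f : Module.End ℂ V} (hf : f ^ m = 1) :
    ∃ (s : Finset ℂ) (n : ℂ → ℕ), (∀ μ ∈ s, μ ^ m = 1) ∧
      ∀ k : ℕ, LinearMap.trace ℂ V (f ^ k) = ∑ μ ∈ s, μ ^ k * n μ := by
  have hss : f.IsSemisimple := by
    apply Module.End.isSemisimple_of_squarefree_aeval_eq_zero
      (p := (Polynomial.X ^ m - 1 : Polynomial ℂ))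
    · exact (Polynomial.X_pow_sub_one_separable_iff.2 (Nat.cast_ne_zero.2 hm)).squarefree
    · simp [hf]
  have htop : ⨆ μ, f.eigenspace μ = ⊤ := by
    rw [← hss.isFinitelySemisimple.iSup_maxGenEigenspace_eq_top_iff]
    exact Module.End.iSup_maxGenEigenspace_eq_top f
  have hint : DirectSum.IsInternal f.eigenspace :=
    (DirectSum.isInternal_submodule_iff_iSupIndep_and_iSup_eq_top _).2
      ⟨f.eigenspaces_iSupIndep, htop⟩
  have hfin : {μ | f.eigenspace μ ≠ ⊥}.Finite := WellFoundedGT.finite_ne_bot_of_iSupIndep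
    f.eigenspaces_iSupIndep
  have hpow (k : ℕ) (μ : ℂ) (v : V) (hv : v ∈ f.eigenspace μ) : (f ^ k) v = μ ^ k • v := by
    induction k with
    | zero => simp
    | succ k ih =>
      rw [pow_succ', Module.End.mul_apply, ih, map_smul, Module.End.mem_eigenspace_iff.1 hv,
        smul_smul, pow_succ]
  have hmaps (k : ℕ) (μ : ℂ) : Set.MapsTo (f ^ k) (f.eigenspace μ) (f.eigenspace μ) := by
    intro v hv
    rw [hpow k μ v hv]
    exact Submodule.smul_mem _ _ hv
  refine ⟨hfin.toFinset, fun μ => finrank ℂ (f.eigenspace μ), fun μ hμ => ?_, fun k => ?_⟩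
  · rw [Set.Finite.mem_toFinset] at hμ
    obtain ⟨v, hv, hv0⟩ := (Submodule.ne_bot_iff _).1 hμ
    have h := hpow m μ v hv
    rw [hf, Module.End.one_apply] at h
    exact smul_left_injective ℂ hv0 (by simpa using h.symm)
  · rw [LinearMap.trace_eq_sum_trace_restrict' hint hfin (hmaps k)]
    refine Finset.sum_congr rfl fun μ _ => ?_
    have : (f ^ k).restrict (hmaps k μ) = μ ^ k • LinearMap.id := by
      ext v
      exact hpow k μ v v.2
    rw [this, map_smul, LinearMap.trace_id, smul_eq_mul]

variable {m : ℕ} [NeZero m] {K : Type*} [Field K] [Algebra ℚ K] [IsCyclotomicExtension {m} ℚ K]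

/-- The cyclotomic automorphism `σ_t` maps `χ(g)` to `χ(g ^ t)`. -/
lemma exists_galois_trace {G V : Type*} [Group G] [AddCommGroup V] [Module ℂ V]
    [FiniteDimensional ℂ V] (j : K →ₐ[ℚ] ℂ) (hirr : Irreducible (Polynomial.cyclotomic m ℚ))
    (ρ : Representation ℂ G V) (g : G) (hg : g ^ m = 1) :
    ∃ x : K, j x = LinearMap.trace ℂ V (ρ g) ∧ ∀ σ : Gal(K/ℚ),
      j (σ x) = LinearMap.trace ℂ V
        (ρ (g ^ (IsCyclotomicExtension.autEquivPow K hirr σ : ZMod m).val)) := by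
  obtain ⟨s, n, hs, htr⟩ := exists_trace_pow_eq_sum (NeZero.ne m) (f := ρ g)
    (by rw [← map_pow, hg, map_one])
  have hζ := IsCyclotomicExtension.zeta_spec m ℚ K
  have hjζ : IsPrimitiveRoot (j (IsCyclotomicExtension.zeta m ℚ K)) m :=
    hζ.map_of_injective j.injective
  have hroot (μ : ℂ) : ∃ i : ℕ, μ ∈ s →
      j (IsCyclotomicExtension.zeta m ℚ K ^ i) = μ := by
    by_cases hμ : μ ∈ s
    · obtain ⟨i, -, hi⟩ := hjζ.eq_pow_of_pow_eq_one (hs μ hμ)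
      exact ⟨i, fun _ => by rw [map_pow, hi]⟩
    · exact ⟨0, fun h => absurd h hμ⟩
  choose i hi using hroot
  refine ⟨∑ μ ∈ s, IsCyclotomicExtension.zeta m ℚ K ^ i μ * n μ, ?_, fun σ => ?_⟩
  · have h1 := htr 1
    simp only [pow_one] at h1
    rw [h1, map_sum]
    refine Finset.sum_congr rfl fun μ hμ => ?_
    rw [map_mul, hi μ hμ, map_natCast]
  · rw [map_pow, htr, map_sum, map_sum]
    refine Finset.sum_congr rfl fun μ hμ => ?_
    have hσ : IsCyclotomicExtension.zeta m ℚ K ^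
        (IsCyclotomicExtension.autEquivPow K hirr σ : ZMod m).val =
          σ (IsCyclotomicExtension.zeta m ℚ K) := hζ.autToPow_spec ℚ σ
    rw [map_mul, map_mul, map_natCast, map_natCast, map_pow σ, ← hσ, ← pow_mul,
      mul_comm _ (i μ), pow_mul, map_pow, hi μ hμ]

end GaloisAction

lemma sum_image_pow_unit {G M : Type*} [Group G] [DecidableEq G] [AddCommMonoid M]
    (S : Finset G) (t : (ZMod (Monoid.exponent G))ˣ) (F : G → M) :
    ∑ x ∈ S.image (fun s => s ^ (t : ZMod (Monoid.exponent G)).val), F x =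
      ∑ s ∈ S, F (s ^ (t : ZMod (Monoid.exponent G)).val) := by
  refine Finset.sum_image fun x _ y _ h => ?_
  have key (x : G) : (x ^ (t : ZMod (Monoid.exponent G)).val) ^
      ((t⁻¹ : (ZMod (Monoid.exponent G))ˣ) : ZMod (Monoid.exponent G)).val = x := by
    rw [← pow_mul, Monoid.pow_eq_mod_exponent, ← ZMod.val_mul, ← Units.val_mul, mul_inv_cancel,
      Units.val_one, ZMod.val_one_eq_one_mod, ← Monoid.pow_eq_mod_exponent, pow_one]
  rw [← key x, ← key y]
  exact congrArg (· ^ _) h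

lemma finrank_map_mul_finrank {k K L : Type*} [Field k] [Field K] [Field L] [Algebra k K]
    [Algebra k L] (j : K →ₐ[k] L) (F : IntermediateField k K) :
    finrank k (F.map j) * finrank F K = finrank k K := by
  rw [← (F.equivMap j).toLinearEquiv.finrank_eq, Module.finrank_mul_finrank]

lemma finrank_adjoin_mul_card {G : Type*} [Group G] [Fintype G] [DecidableEq G]
    {K : Type*} [Field K] [Algebra ℚ K] [IsCyclotomicExtension {Monoid.exponent G} ℚ K]
    (j : K →ₐ[ℚ] ℂ) (S : Finset G) (hS : ∀ g : G, S.image (fun x => g⁻¹ * x * g) = S) :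
    Module.finrank ℚ
        (IntermediateField.adjoin ℚ {z : ℂ | ∃ χ : G → ℂ, IsIrrChar G χ ∧ z = ∑ s ∈ S, χ s}) *
      Nat.card {t : (ZMod (Monoid.exponent G))ˣ |
        S.image (fun s => s ^ ((t : ZMod (Monoid.exponent G)).val)) = S} =
      Nat.totient (Monoid.exponent G) := by
  have : NeZero (Monoid.exponent G) := ⟨Monoid.exponent_ne_zero_of_finite⟩
  have hirr : Irreducible (Polynomial.cyclotomic (Monoid.exponent G) ℚ) :=
    Polynomial.cyclotomic.irreducible_rat (NeZero.pos _)
  have : IsGalois ℚ K := IsCyclotomicExtension.isGalois {Monoid.exponent G} ℚ K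
  have : FiniteDimensional ℚ K := IsCyclotomicExtension.finiteDimensional {Monoid.exponent G} ℚ K
  let e := IsCyclotomicExtension.autEquivPow K hirr
  have hchar (χ : G → ℂ) (hχ : IsIrrChar G χ) : ∃ x : K, j x = ∑ s ∈ S, χ s ∧ ∀ σ : Gal(K/ℚ),
      j (σ x) = ∑ s ∈ S.image (fun s => s ^ (e σ : ZMod (Monoid.exponent G)).val), χ s := by
    obtain ⟨V, _, _, _, _, ρ, -, hχρ⟩ := hχ
    choose x hx hσ using fun g : G => exists_galois_trace j hirr ρ g (Monoid.pow_exponent_eq_one g)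
    refine ⟨∑ s ∈ S, x s, ?_, fun σ => ?_⟩
    · simp only [map_sum, hx, hχρ]
    · rw [sum_image_pow_unit]
      simp only [map_sum, hσ, hχρ, e]
  let Z : Set K := {x | ∃ χ : G → ℂ, IsIrrChar G χ ∧ j x = ∑ s ∈ S, χ s}
  have hZ : j '' Z = {z : ℂ | ∃ χ : G → ℂ, IsIrrChar G χ ∧ z = ∑ s ∈ S, χ s} := by
    ext z
    constructor
    · rintro ⟨x, ⟨χ, hχ, hx⟩, rfl⟩
      exact ⟨χ, hχ, hx⟩
    · rintro ⟨χ, hχ, rfl⟩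
      obtain ⟨x, hx, -⟩ := hchar χ hχ
      exact ⟨x, ⟨χ, hχ, hx⟩, hx⟩
  have hfix (σ : Gal(K/ℚ)) : σ ∈ (IntermediateField.adjoin ℚ Z).fixingSubgroup ↔
      S.image (fun s => s ^ ((e σ : ZMod (Monoid.exponent G)).val)) = S := by
    have h1 : σ ∈ (IntermediateField.adjoin ℚ Z).fixingSubgroup ↔ ∀ x ∈ Z, σ x = x := by
      rw [← Subgroup.zpowers_le, ← IntermediateField.le_iff_le, IntermediateField.adjoin_le_iff]
      simp only [Set.subset_def, SetLike.mem_coe, IntermediateField.mem_fixedField_iff]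
      refine forall₂_congr fun x _ => ⟨fun h => h σ (Subgroup.mem_zpowers σ), fun h τ hτ => ?_⟩
      have : Subgroup.zpowers σ ≤ MulAction.stabilizer Gal(K/ℚ) x := by
        rw [Subgroup.zpowers_le]
        exact h
      exact this hτ
    rw [h1]
    constructor
    · intro h
      refine eq_of_forall_isIrrChar_sum_eq (image_pow_conj hS _) hS fun χ hχ => ?_
      obtain ⟨x, hx, hσ⟩ := hchar χ hχ
      rw [← hσ, h x ⟨χ, hχ, hx⟩, hx]
    · rintro h x ⟨χ, hχ, hx⟩
      obtain ⟨y, hy, hσ⟩ := hchar χ hχ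
      obtain rfl : x = y := j.injective (hx.trans hy.symm)
      have hj : j (σ x) = j x := by rw [hσ, h, hx]
      exact j.injective hj
  have hcard : Nat.card {t : (ZMod (Monoid.exponent G))ˣ |
      S.image (fun s => s ^ ((t : ZMod (Monoid.exponent G)).val)) = S} =
      Nat.card (IntermediateField.adjoin ℚ Z).fixingSubgroup :=
    (Nat.card_congr (e.toEquiv.subtypeEquiv hfix)).symm
  rw [hcard, IsGalois.card_fixingSubgroup_eq_finrank, ← hZ, ← IntermediateField.adjoin_map,
    finrank_map_mul_finrank, IsCyclotomicExtension.finrank K hirr]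

end

theorem stmt_14 {G : Type*} [Group G] [Fintype G] [DecidableEq G]
    (S : Finset G) (hS : ∀ g : G, S.image (fun x => g⁻¹ * x * g) = S)
    (SF : IntermediateField ℚ ℂ)
    (hSF : SF = IntermediateField.adjoin ℚ
      {z : ℂ | Polynomial.aeval z (cayMatrix S).charpoly = 0})
    (T : Set (ZMod (Monoid.exponent G))ˣ)
    (hT : T = {t : (ZMod (Monoid.exponent G))ˣ | S.image (fun s => s ^ ((t : ZMod (Monoid.exponent G)).val)) = S}) :
    SF = IntermediateField.adjoin ℚ
        {z : ℂ | ∃ χ : G → ℂ, IsIrrChar G χ ∧ z = ∑ s ∈ S, χ s}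
      ∧ Module.finrank ℚ ↥SF * Nat.card T = Nat.totient (Monoid.exponent G) := by
  subst hSF hT
  rw [adjoin_roots_eq_adjoin_characters hS]
  have : NeZero (Monoid.exponent G) := ⟨Monoid.exponent_ne_zero_of_finite⟩
  let _ := CyclotomicField.algebra (Monoid.exponent G) ℚ
  have := CyclotomicField.isCyclotomicExtension (Monoid.exponent G) ℚ
  have := IsCyclotomicExtension.finiteDimensional {Monoid.exponent G} ℚ
    (CyclotomicField (Monoid.exponent G) ℚ)
  exact ⟨rfl, finrank_adjoin_mul_card
    (IsAlgClosed.lift : CyclotomicField (Monoid.exponent G) ℚ →ₐ[ℚ] ℂ) S hS⟩
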